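/- Let η ≥ 2 be an integer and let S and N be disjoint finite vertex sets. Let T be a tree with vertex set S ∪ N such that every v ∈ N has degree strictly greater than η in T, and let T_S be any tree with vertex set S. Then there exists a function π: E(T) × {1, 2, …, η−1} → E(T_S) such that (1) for every e ∈ E(T) and every 1 ≤ i ≤ η−1, the edge e lies on the unique path in T between the endpoints of π(e,i) (i.e. e is a friend of π(e,i) with respect to T), and (2) for every edge e' ∈ E(T_S), the preimage π^{-1}(e') has at most η elements. -/

import Mathlib

open SimpleGraph

/-- `e` is a friend of `e'` with respect to the tree-subgraph `H`: `e` is an edge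
of `H` lying on the (unique, since `H` is a tree) path in `H` between the endpoints
of `e'`. -/
def FriendOf {V : Type*} (H : (⊤ : SimpleGraph V).Subgraph) (e e' : Sym2 V) : Prop :=
  e ∈ H.edgeSet ∧ ∃ u v : V, e' = s(u, v) ∧
    ∃ p : H.spanningCoe.Walk u v, p.IsPath ∧ e ∈ p.edges

namespace SimpleGraph

open Finset

variable {W X C : Type*}

/-- The edges of a connected graph whose endpoints have distinct images under `f` suffice to
connect the image of `f`. -/
theorem Connected.card_image_le_card_filter_edgeFinset_add_one [Fintype X] [DecidableEq C]
    {H : SimpleGraph X} [Fintype H.edgeSet] (hH : H.Connected) (f : X → C) :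
    #(univ.image f) ≤ #{e ∈ H.edgeFinset | ¬ (e.map f).IsDiag} + 1 := by
  classical
  let g : X → univ.image f := fun x ↦ ⟨f x, mem_image_of_mem f (mem_univ x)⟩
  have hreach : ∀ x y, (H.map g).Reachable (g x) (g y) := by
    intro x y
    obtain ⟨p⟩ := hH.preconnected x y
    induction p with
    | nil => rfl
    | @cons u v w h p ih =>
      refine Reachable.trans ?_ ih
      by_cases huv : g u = g v
      · rw [huv]
      · exact Adj.reachable ⟨huv, u, v, h, rfl, rfl⟩
  have hconn : (H.map g).Connected := by
    have := hH.nonempty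
    have : Nonempty (univ.image f) := ⟨g (Classical.arbitrary X)⟩
    refine ⟨fun a b ↦ ?_⟩
    obtain ⟨x, -, hx⟩ := mem_image.1 a.2
    obtain ⟨y, -, hy⟩ := mem_image.1 b.2
    rw [show a = g x from Subtype.ext hx.symm, show b = g y from Subtype.ext hy.symm]
    exact hreach x y
  have hsub : (H.map g).edgeFinset ⊆
      {e ∈ H.edgeFinset | ¬ (e.map f).IsDiag}.image (Sym2.map g) := by
    intro e he
    induction e with | _ a b
    obtain ⟨hab, x, y, hxy, rfl, rfl⟩ := mem_edgeFinset.1 he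
    refine mem_image.2 ⟨s(x, y), ?_, rfl⟩
    simp only [mem_filter, mem_edgeFinset, mem_edgeSet, Sym2.map_mk, Sym2.mk_isDiag_iff]
    exact ⟨hxy, fun h ↦ hab (Subtype.ext h)⟩
  have hcard := hconn.card_vert_le_card_edgeSet_add_one
  rw [Nat.card_eq_fintype_card, Fintype.card_coe, Nat.card_eq_fintype_card,
    ← edgeFinset_card] at hcard
  exact hcard.trans (Nat.add_le_add_right ((card_le_card hsub).trans card_image_le) 1)

/-- A finite tree rooted at `r` has a parent function: it decreases the distance to `r` and
its pairs are exactly the edges of the tree. -/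
theorem IsTree.exists_parent [Fintype W] {G : SimpleGraph W} (hG : G.IsTree) (r : W) :
    ∃ p : W → W, (∀ x ≠ r, G.Adj x (p x)) ∧ (∀ x ≠ r, G.dist r (p x) < G.dist r x) ∧
      Set.InjOn (fun x ↦ s(x, p x)) {x | x ≠ r} ∧
      ∀ e ∈ G.edgeSet, ∃ x ≠ r, s(x, p x) = e := by
  classical
  have hex : ∀ x, ∃ y, x ≠ r → G.Adj x y ∧ G.dist r y < G.dist r x := by
    intro x
    by_cases hx : x = r
    · exact ⟨x, fun h ↦ absurd hx h⟩
    obtain ⟨q, hq⟩ := hG.connected.exists_walk_length_eq_dist x r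
    cases q with
    | nil => exact absurd rfl hx
    | @cons _ y _ h q =>
      refine ⟨y, fun _ ↦ ⟨h, ?_⟩⟩
      have := dist_le q
      rw [Walk.length_cons] at hq
      rw [dist_comm, G.dist_comm (u := r)]
      omega
  choose p hp using hex
  have hinj : Set.InjOn (fun x ↦ s(x, p x)) {x | x ≠ r} := by
    intro x hx y hy hxy
    rcases Sym2.eq_iff.1 hxy with ⟨h, -⟩ | ⟨h₁, h₂⟩
    · exact h
    · have hdx := (hp x hx).2
      have hdy := (hp y hy).2
      rw [h₂] at hdx
      rw [← h₁] at hdy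
      omega
  refine ⟨p, fun x hx ↦ (hp x hx).1, fun x hx ↦ (hp x hx).2, hinj, ?_⟩
  have hsub : (univ.erase r).image (fun x ↦ s(x, p x)) ⊆ G.edgeFinset := by
    intro e he
    obtain ⟨x, hx, rfl⟩ := mem_image.1 he
    exact mem_edgeFinset.2 (hp x (ne_of_mem_erase hx)).1
  have heq := eq_of_subset_of_card_le hsub (by
    rw [card_image_of_injOn (hinj.mono fun x hx ↦ ne_of_mem_erase hx),
      card_erase_of_mem (mem_univ r), card_univ, ← hG.card_edgeFinset, Nat.add_sub_cancel])
  intro e he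
  rw [← mem_edgeFinset, ← heq] at he
  obtain ⟨x, hx, rfl⟩ := mem_image.1 he
  exact ⟨x, ne_of_mem_erase hx, rfl⟩

/-- Following a depth-decreasing map `p` until a set `A` containing the root is reached. -/
theorem exists_first_ancestor (r : W) (p : W → W) (d : W → ℕ) (hd : ∀ x ≠ r, d (p x) < d x)
    (A : Set W) (hr : r ∈ A) :
    ∃ t : W → W, (∀ x ∈ A, t x = x) ∧ ∀ x ∉ A, t x = t (p x) := by
  classical
  have hwf : WellFounded fun x y : W ↦ d x < d y := (measure d).wf
  let F : (x : W) → ((y : W) → d y < d x → W) → W := fun x ih ↦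
    if h : x ∈ A then x else ih (p x) (hd x fun hx ↦ h (hx ▸ hr))
  refine ⟨hwf.fix F, fun x hx ↦ ?_, fun x hx ↦ ?_⟩
  · rw [hwf.fix_eq]
    exact dif_pos hx
  · rw [hwf.fix_eq]
    exact dif_neg hx

/-- Hall's condition for friends: if every vertex outside the image of `f` has degree more than
`η` in the tree `G`, then a set `F` of edges of `G` is met by the tree paths spanned by
many edges of the connected graph `H`. -/
theorem IsTree.mul_card_le_mul_card_filter_edgeFinset [Fintype W] [Fintype X]
    {G : SimpleGraph W} (hG : G.IsTree) {H : SimpleGraph X} [Fintype H.edgeSet]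
    (hH : H.Connected) (f : X → W) {η : ℕ} (hη : 1 ≤ η)
    (hdeg : ∀ w ∉ Set.range f, η < (G.neighborSet w).ncard)
    (F : Finset (Sym2 W)) (hF : ∀ e ∈ F, e ∈ G.edgeSet) (D : Finset (Sym2 X))
    (hD : ∀ u v, H.Adj u v → s(u, v) ∉ D →
      ∃ q : G.Walk (f u) (f v), ∀ e ∈ q.edges, e ∉ F) :
    (η - 1) * #F ≤ η * #D := by
  classical
  obtain ⟨x₀⟩ := hH.nonempty
  obtain ⟨p, -, hdist, hinj, hsurj⟩ := hG.exists_parent (f x₀)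
  set r := f x₀ with hr
  let A : Finset W := {x | x ≠ r ∧ s(x, p x) ∈ F}
  have hAF : #A = #F := by
    refine card_bij (fun x _ ↦ s(x, p x)) (fun x hx ↦ (mem_filter.1 hx).2.2)
      (fun x hx y hy h ↦ hinj (mem_filter.1 hx).2.1 (mem_filter.1 hy).2.1 h) fun e he ↦ ?_
    obtain ⟨x, hx, rfl⟩ := hsurj e (hF e he)
    exact ⟨x, mem_filter.2 ⟨mem_univ x, hx, he⟩, rfl⟩
  obtain ⟨t, htA, htp⟩ := exists_first_ancestor r p (G.dist r) hdist (insert r A : Finset W)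
    (by simp)
  have htr : t r = r := htA r (by simp)
  have htwalk : ∀ {u v : W} (q : G.Walk u v), (∀ e ∈ q.edges, e ∉ F) → t u = t v := by
    intro u v q hq
    induction q with
    | nil => rfl
    | @cons u v w h q ih =>
      rw [← ih fun e he ↦ hq e (by simp [he])]
      have huv : s(u, v) ∉ F := hq _ (by simp)
      obtain ⟨x, hx, hxe⟩ := hsurj s(u, v) h
      have hxt : t x = t (p x) := htp x (by simp [A, hx, hxe, huv])
      rcases Sym2.eq_iff.1 hxe with ⟨rfl, rfl⟩ | ⟨rfl, rfl⟩
      · exact hxt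
      · exact hxt.symm
  let K : Finset W := univ.image fun x ↦ t (f x)
  have hK : #K ≤ #D + 1 := by
    refine (hH.card_image_le_card_filter_edgeFinset_add_one fun x ↦ t (f x)).trans
      (Nat.add_le_add_right (card_le_card fun e he ↦ ?_) 1)
    induction e with | _ u v
    simp only [mem_filter, mem_edgeFinset, mem_edgeSet, Sym2.map_mk, Sym2.mk_isDiag_iff] at he
    by_contra h
    obtain ⟨q, hq⟩ := hD u v he.1 h
    exact he.2 (htwalk q hq)
  have hAK : #A + 1 ≤ #K + #(A \ K) := by
    have hrA : r ∉ A := by simp [A]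
    rw [← card_insert_of_notMem hrA]
    refine (card_le_card ?_).trans (card_union_le _ _)
    intro x hx
    rcases mem_insert.1 hx with rfl | hx
    · exact mem_union_left _ (mem_image.2 ⟨x₀, mem_univ _, htr⟩)
    · by_cases hxK : x ∈ K <;> simp [hx, hxK]
  let U : Finset W := {x | t x ∉ K}
  have hAU : A \ K ⊆ U := by
    intro x hx
    obtain ⟨hxA, hxK⟩ := mem_sdiff.1 hx
    refine mem_filter.2 ⟨mem_univ x, ?_⟩
    rwa [htA x (by simp [hxA])]
  have hchildren : η * #U ≤ #A + #(U \ (A \ K)) := by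
    calc η * #U ≤ #({x | x ≠ r ∧ p x ∈ U} : Finset W) := by
          rw [mul_comm, ← smul_eq_mul, card_eq_sum_card_fiberwise (f := p) (t := U)
            (s := {x | x ≠ r ∧ p x ∈ U}) fun x hx ↦
            (mem_filter.1 (mem_coe.1 hx)).2.2]
          refine card_nsmul_le_sum _ _ _ fun u hu ↦ ?_
          have huf : u ∉ Set.range f := by
            rintro ⟨x, rfl⟩
            exact (mem_filter.1 hu).2 (mem_image_of_mem _ (mem_univ x))
          have hlt := hdeg u huf
          let c : Finset W := {x ∈ ({x | x ≠ r ∧ p x ∈ U} : Finset W) | p x = u}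
          have hsub : G.neighborSet u ⊆ (insert (p u) c : Finset W) := by
            intro y hy
            obtain ⟨x, hx, hxe⟩ := hsurj s(u, y) hy
            rcases Sym2.eq_iff.1 hxe with ⟨rfl, rfl⟩ | ⟨rfl, rfl⟩
            · simp
            · simp [c, hx, hu]
          have hle := Set.ncard_le_ncard hsub
          rw [Set.ncard_coe_finset] at hle
          exact Nat.le_of_lt_succ (hlt.trans_le (hle.trans (card_insert_le _ _)))
      _ ≤ #(A ∪ U \ (A \ K)) := by
          refine card_le_card fun x hx ↦ ?_
          obtain ⟨-, hxr, hxU⟩ := mem_filter.1 hx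
          by_cases hxA : x ∈ A
          · exact mem_union_left _ hxA
          · have hxt : t x = t (p x) := htp x (by simp [hxA, hxr])
            refine mem_union_right _ (mem_sdiff.2 ⟨mem_filter.2 ⟨mem_univ x, ?_⟩,
              fun h ↦ hxA (mem_sdiff.1 h).1⟩)
            rw [hxt]
            exact (mem_filter.1 hxU).2
      _ ≤ _ := card_union_le _ _
  rw [card_sdiff_of_subset hAU] at hchildren
  have hle := card_le_card hAU
  obtain ⟨m, rfl⟩ : ∃ m, η = m + 1 := ⟨η - 1, by omega⟩
  rw [← hAF]
  generalize #(A \ K) = n at *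
  have h₁ : m * #U + n ≤ #A := by
    have : (m + 1) * #U = m * #U + #U := by ring
    omega
  have h₂ : m * n ≤ m * #U := Nat.mul_le_mul_left m hle
  have h₃ : (m + 1) * #A ≤ (m + 1) * (#D + n) := Nat.mul_le_mul_left _ (by omega)
  rw [Nat.add_sub_cancel]
  nlinarith

end SimpleGraph

/-- Let `η ≥ 2`, let `S` and `N` be disjoint vertex sets, let `T` be a tree on
vertex set `S ∪ N` in which every `v ∈ N` has degree `> η`, and let `TS` be any
tree on vertex set `S`.  Then there is `π : E(T) × {1, …, η−1} → E(TS)` such that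
(1) `e` is a friend of `π (e, i)` with respect to `T` for all `e, i`, and
(2) every `e' ∈ E(TS)` has at most `η` preimages under `π`. -/
theorem stmt7 {V : Type*} [Fintype V]
    (η : ℕ) (hη : 2 ≤ η)
    (S N : Set V) (hSN : Disjoint S N)
    (T : (⊤ : SimpleGraph V).Subgraph) (hT : T.coe.IsTree) (hTv : T.verts = S ∪ N)
    (hdeg : ∀ v ∈ N, η < Nat.card (T.neighborSet v))
    (TS : (⊤ : SimpleGraph V).Subgraph) (hTS : TS.coe.IsTree) (hTSv : TS.verts = S) :
    ∃ π : T.edgeSet × Fin (η - 1) → TS.edgeSet,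
      (∀ (e : T.edgeSet) (i : Fin (η - 1)),
        FriendOf T (e : Sym2 V) ((π (e, i) : Sym2 V))) ∧
      ∀ e' : TS.edgeSet, (π ⁻¹' {e'}).ncard ≤ η := by
  classical
  have hsub : TS.verts ⊆ T.verts := by
    rw [hTSv, hTv]
    exact Set.subset_union_left
  obtain ⟨g, hg, hgR⟩ := (Fintype.all_card_le_filter_rel_iff_exists_injective
    fun (a : T.edgeSet × Fin (η - 1)) (b : TS.edgeSet × Fin η) ↦
      FriendOf T (a.1 : Sym2 V) (b.1 : Sym2 V)).1 (by
    intro A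
    let F : Finset (Sym2 T.verts) := {e | ∃ a ∈ A, Sym2.map Subtype.val e = a.1}
    let D : Finset (Sym2 TS.verts) :=
      {e | e ∈ TS.coe.edgeSet ∧ ∃ a ∈ A, FriendOf T (a.1 : Sym2 V) (e.map Subtype.val)}
    have key : (η - 1) * F.card ≤ η * D.card := by
      refine hT.mul_card_le_mul_card_filter_edgeFinset hTS.connected (Set.inclusion hsub)
        (by omega) ?_ F ?_ D ?_
      · intro w hw
        have hwN : (w : V) ∈ N := by
          rcases hTv.subset w.2 with h | h
          · exact absurd ⟨⟨w, hTSv.superset h⟩, rfl⟩ hw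
          · exact h
        rw [← Nat.card_coe_set_eq, Nat.card_congr (T.coeNeighborSetEquiv w)]
        exact hdeg w hwN
      · intro e he
        obtain ⟨a, -, hea⟩ := (Finset.mem_filter.1 he).2
        induction e with | _ x y
        have := a.1.2
        rw [← hea] at this
        exact this
      · intro u v huv huvD
        obtain ⟨q, hq⟩ := hT.connected.preconnected.exists_isPath
          (Set.inclusion hsub u) (Set.inclusion hsub v)
        refine ⟨q, fun e he heF ↦ huvD ?_⟩
        obtain ⟨a, ha, hea⟩ := (Finset.mem_filter.1 heF).2
        refine Finset.mem_filter.2 ⟨Finset.mem_univ _, huv, a, ha, a.1.2, u, v, rfl,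
          q.map T.coeEmbeddingSpanningCoe.toHom, hq.map T.coeEmbeddingSpanningCoe.injective, ?_⟩
        exact hea ▸ (Walk.edges_map T.coeEmbeddingSpanningCoe.toHom q).symm ▸
          List.mem_map_of_mem he
    have hAF : A.card ≤ (η - 1) * F.card := by
      have h₁ : ((A.image Prod.fst).image Subtype.val) ⊆ F.image (Sym2.map Subtype.val) := by
        intro e he
        obtain ⟨e₀, he₀, rfl⟩ := Finset.mem_image.1 he
        obtain ⟨⟨⟨e, hTe⟩, i⟩, ha, rfl⟩ := Finset.mem_image.1 he₀
        induction e with | _ x y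
        refine Finset.mem_image.2
          ⟨s(⟨x, T.edge_vert hTe⟩, ⟨y, T.edge_vert hTe.symm⟩), ?_, rfl⟩
        exact Finset.mem_filter.2 ⟨Finset.mem_univ _, _, ha, rfl⟩
      have h₂ := (Finset.card_le_card h₁).trans Finset.card_image_le
      rw [Finset.card_image_of_injective _ Subtype.val_injective] at h₂
      have h₃ := Finset.card_le_card (Finset.subset_product (s := A))
      rw [Finset.card_product] at h₃
      have h₄ := Finset.card_le_univ (A.image Prod.snd)
      rw [Fintype.card_fin] at h₄
      exact h₃.trans ((Nat.mul_le_mul h₂ h₄).trans_eq (mul_comm _ _))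
    let D' : Finset TS.edgeSet := {e | ∃ a ∈ A, FriendOf T (a.1 : Sym2 V) e}
    have hDD' : D.card ≤ D'.card := by
      have h₁ : D.image (Sym2.map Subtype.val) ⊆ D'.image Subtype.val := by
        intro e he
        obtain ⟨e₀, he₀, rfl⟩ := Finset.mem_image.1 he
        obtain ⟨hTe, h⟩ := (Finset.mem_filter.1 he₀).2
        induction e₀ with | _ x y
        exact Finset.mem_image.2 ⟨⟨s(x, y), hTe⟩, Finset.mem_filter.2 ⟨Finset.mem_univ _, h⟩, rfl⟩
      have h₂ := Finset.card_le_card h₁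
      rwa [Finset.card_image_of_injective _ (Sym2.map.injective Subtype.val_injective),
        Finset.card_image_of_injective _ Subtype.val_injective] at h₂
    calc A.card ≤ η * D'.card := hAF.trans (key.trans (Nat.mul_le_mul_left η hDD'))
      _ = (D' ×ˢ (Finset.univ : Finset (Fin η))).card := by
          rw [Finset.card_product, Finset.card_univ, Fintype.card_fin, mul_comm]
      _ ≤ _ := Finset.card_le_card fun b hb ↦ by
          obtain ⟨h, -⟩ := Finset.mem_product.1 hb
          exact Finset.mem_filter.2 ⟨Finset.mem_univ _, (Finset.mem_filter.1 h).2⟩)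
  refine ⟨fun a ↦ (g a).1, fun e i ↦ hgR (e, i), fun e' ↦ ?_⟩
  calc _ ≤ (Set.univ : Set (Fin η)).ncard := by
        refine Set.ncard_le_ncard_of_injOn (fun a ↦ (g a).2) (fun _ _ ↦ Set.mem_univ _) ?_
        intro a ha b hb hab
        exact hg (Prod.ext (ha.trans hb.symm) hab)
    _ = η := by simp
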